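/- Speed of order-hereditary properties: Let k ≥ 2, let P be an order-hereditary property of k-colourings with P_n ≠ ∅ for every n ∈ ℕ, and let ε > 0 be fixed. There exists n₀ ∈ ℕ such that for all n ≥ n₀, k^{π(P)·C(n,2)} ≤ |P_n| ≤ k^{(π(P)+ε)·C(n,2)}. -/

import Mathlib

open Filter

abbrev Edge (n : ℕ) := {p : Fin n × Fin n // p.1 < p.2}

abbrev Colouring (k n : ℕ) := Edge n → Fin k

abbrev Template (k n : ℕ) := Edge n → Finset (Fin k)

def Proper {k n : ℕ} (t : Template k n) : Prop := ∀ e, (t e).Nonempty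

def Realises {k n : ℕ} (c : Colouring k n) (t : Template k n) : Prop := ∀ e, c e ∈ t e

noncomputable def Ent {k n : ℕ} (t : Template k n) : ℝ :=
  ∑ e : Edge n, Real.logb k ((t e).card)

def Edge.map {m n : ℕ} (φ : Fin m → Fin n) (h : StrictMono φ) (e : Edge m) : Edge n :=
  ⟨(φ e.1.1, φ e.1.2), h e.2⟩

def restrictC {k m n : ℕ} (c : Colouring k n) (φ : Fin m → Fin n) (h : StrictMono φ) :
    Colouring k m := fun e => c (Edge.map φ h e)

def restrictT {k m n : ℕ} (t : Template k n) (φ : Fin m → Fin n) (h : StrictMono φ) :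
    Template k m := fun e => t (Edge.map φ h e)

def Forb {k N : ℕ} (F : Set (Colouring k N)) (n : ℕ) : Set (Colouring k n) :=
  {c | ∀ (φ : Fin N → Fin n) (h : StrictMono φ), restrictC c φ h ∉ F}

def OrderHereditary {k : ℕ} (P : ∀ n, Set (Colouring k n)) : Prop :=
  ∀ (m n : ℕ) (φ : Fin m → Fin n) (h : StrictMono φ) (c : Colouring k n),
    c ∈ P n → restrictC c φ h ∈ P m

noncomputable def exEnt {k n : ℕ} (A : Set (Colouring k n)) : ℝ :=
  sSup {x | ∃ t : Template k n, Proper t ∧ (∀ c, Realises c t → c ∈ A) ∧ Ent t = x}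

noncomputable def badPairs {k N n : ℕ} (t : Template k n) (F : Set (Colouring k N)) : ℕ :=
  Set.ncard {p : (Fin N → Fin n) × Colouring k N |
    ∃ h : StrictMono p.1, p.2 ∈ F ∧ Realises p.2 (restrictT t p.1 h)}

def TemplateLE {k m n : ℕ} (t : Template k m) (t' : Template k n) : Prop :=
  ∃ (φ : Fin m → Fin n) (h : StrictMono φ), ∀ e, t e ⊆ restrictT t' φ h e

def IsContainerFamily {k n : ℕ} (T : Finset (Template k n)) (A : Set (Colouring k n)) : Prop :=
  ∀ t : Template k n, Proper t → (∀ c, Realises c t → c ∈ A) → ∃ t' ∈ T, TemplateLE t t'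


section Info
open Classical in
noncomputable def cls {ι κ : Type*} (S : Finset (ι → κ)) (Q : Finset ι) (x : ι → κ) :
    Finset (ι → κ) := S.filter (fun y => ∀ e ∈ Q, y e = x e)

noncomputable def LL {ι κ : Type*} (S : Finset (ι → κ)) (Q : Finset ι) : ℝ :=
  ∑ x ∈ S, Real.log ((cls S Q x).card : ℝ)

variable {ι κ : Type*}

lemma mem_cls {S : Finset (ι → κ)} {Q : Finset ι} {x y : ι → κ} :
    y ∈ cls S Q x ↔ y ∈ S ∧ ∀ e ∈ Q, y e = x e := by
  simp [cls]

lemma cls_pos {S : Finset (ι → κ)} (Q : Finset ι) {x : ι → κ} (hx : x ∈ S) :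
    (0 : ℝ) < ((cls S Q x).card : ℝ) := by
  have : x ∈ cls S Q x := mem_cls.2 ⟨hx, fun _ _ => rfl⟩
  exact_mod_cast Finset.card_pos.2 ⟨x, this⟩

lemma cls_eq {S : Finset (ι → κ)} {Q : Finset ι} {x y : ι → κ} (h : y ∈ cls S Q x) :
    cls S Q y = cls S Q x := by
  ext z
  rw [mem_cls] at h
  simp only [mem_cls]
  refine and_congr_right fun _ => ?_
  constructor
  · intro hz e he
    rw [hz e he, h.2 e he]
  · intro hz e he
    rw [hz e he, h.2 e he]

lemma cls_symm {S : Finset (ι → κ)} {Q : Finset ι} {x y : ι → κ} (hx : x ∈ S)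
    (h : y ∈ cls S Q x) : x ∈ cls S Q y := by
  rw [mem_cls] at h ⊢
  exact ⟨hx, fun e he => (h.2 e he).symm⟩

/-- sum over `x` of averages over the class of `x`. -/
lemma sum_avg (S : Finset (ι → κ)) (Q : Finset ι) (F : (ι → κ) → ℝ) :
    ∑ x ∈ S, (((cls S Q x).card : ℝ))⁻¹ * ∑ y ∈ cls S Q x, F y = ∑ y ∈ S, F y := by
  classical
  calc _ = ∑ x ∈ S, ∑ y ∈ cls S Q x, (((cls S Q y).card : ℝ))⁻¹ * F y := by
        refine Finset.sum_congr rfl fun x hx => ?_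
        rw [Finset.mul_sum]
        refine Finset.sum_congr rfl fun y hy => ?_
        rw [cls_eq hy]
    _ = ∑ y ∈ S, ∑ x ∈ cls S Q y, (((cls S Q y).card : ℝ))⁻¹ * F y := by
        refine Finset.sum_comm' fun x y => ?_
        constructor
        · rintro ⟨hx, hy⟩
          exact ⟨cls_symm hx hy, (mem_cls.1 hy).1⟩
        · rintro ⟨hx, hy⟩
          exact ⟨(mem_cls.1 hx).1, cls_symm hy hx⟩
    _ = _ := by
        refine Finset.sum_congr rfl fun y hy => ?_
        rw [Finset.sum_const, nsmul_eq_mul, ← mul_assoc,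
          mul_inv_cancel₀ (cls_pos Q hy).ne', one_mul]

lemma LL_submod [DecidableEq ι] (S : Finset (ι → κ)) {Q Q' : Finset ι} (h : Q ⊆ Q') (e : ι) :
    LL S Q' - LL S (insert e Q') ≤ LL S Q - LL S (insert e Q) := by
  classical
  have key : ∑ x ∈ S, (((cls S (insert e Q) x).card : ℝ) * (cls S Q' x).card /
      (((cls S Q x).card : ℝ) * (cls S (insert e Q') x).card)) ≤ ∑ x ∈ S, (1 : ℝ) := by
    calc _ = ∑ x ∈ S, ∑ y ∈ cls S (insert e Q) x, ∑ z ∈ cls S Q' x,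
            (((cls S Q y).card : ℝ)⁻¹ * ((cls S (insert e Q') x).card : ℝ)⁻¹) := by
          refine Finset.sum_congr rfl fun x hx => ?_
          have : ∀ y ∈ cls S (insert e Q) x, cls S Q y = cls S Q x := by
            intro y hy
            apply cls_eq
            rw [mem_cls] at hy ⊢
            exact ⟨hy.1, fun e' he' => hy.2 e' (Finset.mem_insert_of_mem he')⟩
          rw [Finset.sum_congr rfl (fun y hy => by rw [this y hy])]
          simp only [Finset.sum_const, nsmul_eq_mul]
          rw [div_eq_mul_inv, mul_inv]
          ring
      _ = ∑ y ∈ S, ∑ x ∈ cls S (insert e Q) y, ∑ z ∈ cls S Q' x,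
            (((cls S Q y).card : ℝ)⁻¹ * ((cls S (insert e Q') x).card : ℝ)⁻¹) := by
          refine Finset.sum_comm' fun x y => ?_
          constructor
          · rintro ⟨hx, hy⟩
            exact ⟨cls_symm hx hy, (mem_cls.1 hy).1⟩
          · rintro ⟨hx, hy⟩
            exact ⟨(mem_cls.1 hx).1, cls_symm hy hx⟩
      _ = ∑ y ∈ S, ∑ z ∈ cls S Q y, ∑ x ∈ cls S (insert e Q) y ∩ cls S Q' z,
            (((cls S Q y).card : ℝ)⁻¹ * ((cls S (insert e Q') x).card : ℝ)⁻¹) := by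
          refine Finset.sum_congr rfl fun y hy => ?_
          refine Finset.sum_comm' fun x z => ?_
          simp only [Finset.mem_inter, mem_cls]
          constructor
          · rintro ⟨⟨hx, hxy⟩, hz, hzx⟩
            refine ⟨⟨⟨hx, hxy⟩, hx, fun e he => (hzx e he).symm⟩, hz, fun e' he' => ?_⟩
            rw [hzx e' (h he'), hxy e' (Finset.mem_insert_of_mem he')]
          · rintro ⟨⟨⟨hx, hxy⟩, -, hxz⟩, hz, hzy⟩
            exact ⟨⟨hx, hxy⟩, hz, fun e he => (hxz e he).symm⟩
      _ ≤ ∑ y ∈ S, ∑ z ∈ cls S Q y, ((cls S Q y).card : ℝ)⁻¹ := by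
          refine Finset.sum_le_sum fun y hy => Finset.sum_le_sum fun z hz => ?_
          rw [← Finset.mul_sum]
          refine mul_le_of_le_one_right (by positivity) ?_
          calc _ ≤ ∑ x ∈ cls S (insert e Q) y ∩ cls S Q' z,
                ((cls S (insert e Q) y ∩ cls S Q' z).card : ℝ)⁻¹ := by
                refine Finset.sum_le_sum fun x hx => ?_
                have hsub : cls S (insert e Q) y ∩ cls S Q' z ⊆ cls S (insert e Q') x := by
                  intro w hw
                  simp only [Finset.mem_inter, mem_cls] at hw hx ⊢
                  refine ⟨hw.1.1, fun e' he' => ?_⟩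
                  rcases Finset.mem_insert.1 he' with rfl | he'
                  · rw [hw.1.2 _ (Finset.mem_insert_self _ _),
                      hx.1.2 _ (Finset.mem_insert_self _ _)]
                  · rw [hw.2.2 _ he', hx.2.2 _ he']
                have hp : 0 < (cls S (insert e Q) y ∩ cls S Q' z).card :=
                  Finset.card_pos.2 ⟨x, hx⟩
                have := Finset.card_le_card hsub
                gcongr
            _ ≤ 1 := by
                rw [Finset.sum_const, nsmul_eq_mul]
                exact mul_inv_le_one
      _ = _ := by
          refine Finset.sum_congr rfl fun y hy => ?_
          rw [Finset.sum_const, nsmul_eq_mul, mul_inv_cancel₀ (cls_pos Q hy).ne']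
  have : ∑ x ∈ S, (Real.log ((cls S (insert e Q) x).card : ℝ) + Real.log ((cls S Q' x).card : ℝ)
      - Real.log ((cls S Q x).card : ℝ) - Real.log ((cls S (insert e Q') x).card : ℝ))
      ≤ ∑ x ∈ S, ((((cls S (insert e Q) x).card : ℝ) * (cls S Q' x).card /
      (((cls S Q x).card : ℝ) * (cls S (insert e Q') x).card)) - 1) := by
    refine Finset.sum_le_sum fun x hx => ?_
    have h1 := cls_pos (insert e Q) hx
    have h2 := cls_pos Q' hx
    have h3 := cls_pos Q hx
    have h4 := cls_pos (insert e Q') hx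
    have := Real.log_le_sub_one_of_pos (div_pos (mul_pos h1 h2) (mul_pos h3 h4))
    rw [Real.log_div (mul_pos h1 h2).ne' (mul_pos h3 h4).ne', Real.log_mul h1.ne' h2.ne',
      Real.log_mul h3.ne' h4.ne'] at this
    linarith
  rw [Finset.sum_sub_distrib] at this
  simp only [Finset.sum_sub_distrib, Finset.sum_add_distrib] at this
  unfold LL
  linarith

lemma LL_mono (S : Finset (ι → κ)) {Q Q' : Finset ι} (h : Q ⊆ Q') : LL S Q' ≤ LL S Q := by
  unfold LL
  refine Finset.sum_le_sum fun x hx => ?_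
  apply Real.log_le_log (cls_pos Q' hx)
  have : cls S Q' x ⊆ cls S Q x := by
    intro y hy
    rw [mem_cls] at hy ⊢
    exact ⟨hy.1, fun e he => hy.2 e (h he)⟩
  exact_mod_cast Finset.card_le_card this

/-- subadditivity -/
lemma LL_subadd [DecidableEq ι] (S : Finset (ι → κ)) (Q U : Finset ι) :
    LL S Q - LL S (U ∪ Q) ≤ ∑ e ∈ U, (LL S Q - LL S (insert e Q)) := by
  induction U using Finset.induction_on with
  | empty => simp
  | insert a U ha ih =>
    rw [Finset.sum_insert ha, Finset.insert_union]
    have := LL_submod S (Finset.subset_union_right : Q ⊆ U ∪ Q) a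
    linarith

/-- superadditivity of fully conditioned entropies -/
lemma LL_superadd [DecidableEq ι] (S : Finset (ι → κ)) (Q U : Finset ι) (V : ι → Finset ι)
    (hV : ∀ e ∈ U, (U.erase e) ∪ Q ⊆ V e) :
    ∑ e ∈ U, (LL S (V e) - LL S (insert e (V e))) ≤ LL S Q - LL S (U ∪ Q) := by
  induction U using Finset.induction_on with
  | empty => simp
  | insert a U ha ih =>
    rw [Finset.sum_insert ha, Finset.insert_union]
    have h0 : U ∪ Q ⊆ V a := by
      have := hV a (Finset.mem_insert_self _ _)
      rwa [Finset.erase_insert ha] at this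
    have := LL_submod S h0 a
    have h1 := ih (fun e he => by
      refine Finset.Subset.trans ?_ (hV e (Finset.mem_insert_of_mem he))
      exact Finset.union_subset_union_left
        (Finset.erase_subset_erase _ (Finset.subset_insert _ _)))
    linarith

/-- few classes implies large `LL` -/
lemma LL_lower [Fintype κ] (S : Finset (ι → κ)) (hS : S.Nonempty) [Nonempty κ] (Q : Finset ι) :
    (S.card : ℝ) * (Real.log S.card - Q.card * Real.log (Fintype.card κ)) ≤ LL S Q := by
  classical
  set V : ℝ := (Fintype.card κ : ℝ) ^ Q.card with hVdef
  have hk : (0 : ℝ) < Fintype.card κ := by exact_mod_cast Fintype.card_pos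
  have hV : 0 < V := by positivity
  have hSc : (0 : ℝ) < S.card := by exact_mod_cast Finset.card_pos.2 hS
  have hcount : ∑ x ∈ S, ((cls S Q x).card : ℝ)⁻¹ ≤ V := by
    let f : (ι → κ) → (Q → κ) := fun x e => x e
    have hf : ∀ x y, y ∈ S → (y ∈ cls S Q x ↔ f y = f x) := by
      intro x y hy
      rw [mem_cls]
      simp [f, funext_iff, hy]
    rw [← Finset.sum_fiberwise_of_maps_to (s := S) (t := Finset.univ) (g := f) (by simp)]
    calc _ ≤ ∑ b : Q → κ, (1 : ℝ) := by
          refine Finset.sum_le_sum fun b _ => ?_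
          calc _ = ∑ x ∈ S.filter (fun x => f x = b),
                (((S.filter (fun x => f x = b)).card : ℝ))⁻¹ := by
                refine Finset.sum_congr rfl fun x hx => ?_
                have : cls S Q x = S.filter (fun x => f x = b) := by
                  ext y
                  rw [Finset.mem_filter] at hx ⊢
                  constructor
                  · intro hy
                    have hyS := (mem_cls.1 hy).1
                    exact ⟨hyS, ((hf x y hyS).1 hy).trans hx.2⟩
                  · rintro ⟨hyS, hy⟩
                    exact (hf x y hyS).2 (hy.trans hx.2.symm)
                rw [this]
            _ ≤ 1 := by
                rw [Finset.sum_const, nsmul_eq_mul]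
                exact mul_inv_le_one
      _ = V := by simp [hVdef]
  have : ∑ x ∈ S, (Real.log S.card - Real.log V - Real.log ((cls S Q x).card : ℝ)) ≤
      ∑ x ∈ S, ((S.card : ℝ) / V * ((cls S Q x).card : ℝ)⁻¹ - 1) := by
    refine Finset.sum_le_sum fun x hx => ?_
    have h1 := cls_pos Q hx
    have := Real.log_le_sub_one_of_pos (mul_pos (div_pos hSc hV) (inv_pos.2 h1))
    rw [Real.log_mul (div_pos hSc hV).ne' (inv_pos.2 h1).ne', Real.log_inv,
      Real.log_div hSc.ne' hV.ne'] at this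
    linarith
  rw [Finset.sum_sub_distrib, Finset.sum_sub_distrib, Finset.sum_sub_distrib, ← Finset.mul_sum] at this
  simp only [Finset.sum_const, nsmul_eq_mul, mul_one] at this
  have h2 : (S.card : ℝ) / V * ∑ x ∈ S, ((cls S Q x).card : ℝ)⁻¹ ≤ S.card := by
    calc _ ≤ (S.card : ℝ) / V * V := by gcongr
      _ = _ := by field_simp
  have h3 : Real.log V = Q.card * Real.log (Fintype.card κ) := by
    rw [hVdef, Real.log_pow]
  rw [← h3]
  unfold LL
  linarith

/-- sum of fibre entropies -/
lemma sum_fibre [DecidableEq ι] (S : Finset (ι → κ)) (Q U : Finset ι) :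
    ∑ x ∈ S, (Real.log ((cls S Q x).card : ℝ) - ((cls S Q x).card : ℝ)⁻¹ *
      ∑ y ∈ cls S Q x, Real.log ((cls (cls S Q x) U y).card : ℝ)) = LL S Q - LL S (U ∪ Q) := by
  rw [Finset.sum_sub_distrib]
  unfold LL
  congr 1
  rw [← sum_avg S Q (fun x => Real.log ((cls S (U ∪ Q) x).card : ℝ))]
  refine Finset.sum_congr rfl fun x hx => ?_
  congr 1
  refine Finset.sum_congr rfl fun y hy => ?_
  congr 3
  ext z
  rw [mem_cls] at hy
  simp only [mem_cls, Finset.mem_union]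
  constructor
  · rintro ⟨⟨h1, h2⟩, h3⟩
    refine ⟨h1, ?_⟩
    rintro e (he | he)
    · exact h3 e he
    · rw [h2 e he, hy.2 e he]
  · rintro ⟨h1, h2⟩
    exact ⟨⟨h1, fun e he => by rw [h2 e (Or.inr he), hy.2 e he]⟩, fun e he => h2 e (Or.inl he)⟩

/-- entropy of a pushforward -/
lemma entropy_push {Ω α : Type*} [Fintype α] [DecidableEq α] (B : Finset Ω) (hB : B.Nonempty) (f : Ω → α) :
    ∑ a, Real.negMulLog (((B.filter (fun y => f y = a)).card : ℝ) / B.card) =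
      Real.log B.card - (B.card : ℝ)⁻¹ *
        ∑ y ∈ B, Real.log ((B.filter (fun z => f z = f y)).card : ℝ) := by
  have hBc : (0 : ℝ) < B.card := by exact_mod_cast Finset.card_pos.2 hB
  have h1 : ∀ a, Real.negMulLog (((B.filter (fun y => f y = a)).card : ℝ) / B.card) =
      ∑ y ∈ B.filter (fun y => f y = a), (B.card : ℝ)⁻¹ *
        (Real.log B.card - Real.log ((B.filter (fun z => f z = f y)).card : ℝ)) := by
    intro a
    rw [Finset.sum_congr rfl (g := fun _ => (B.card : ℝ)⁻¹ *
        (Real.log B.card - Real.log ((B.filter (fun z => f z = a)).card : ℝ)))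
        (fun y hy => by rw [(Finset.mem_filter.1 hy).2])]
    rw [Finset.sum_const, nsmul_eq_mul, Real.negMulLog]
    rcases Finset.eq_empty_or_nonempty (B.filter (fun y => f y = a)) with h | h
    · simp [h]
    · have : (0 : ℝ) < (B.filter (fun y => f y = a)).card := by
        exact_mod_cast Finset.card_pos.2 h
      rw [Real.log_div this.ne' hBc.ne']
      ring
  rw [Finset.sum_congr rfl (fun a _ => h1 a),
    Finset.sum_fiberwise_of_maps_to (s := B) (t := Finset.univ) (g := f) (by simp),
    ← Finset.mul_sum, Finset.sum_sub_distrib, Finset.sum_const, nsmul_eq_mul, mul_sub,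
    ← mul_assoc, inv_mul_cancel₀ hBc.ne', one_mul]

end Info

section Compact
set_option linter.unusedSectionVars false
variable {ι κ : Type*} [Fintype ι] [Fintype κ] [DecidableEq ι] [DecidableEq κ]

/-- marginal -/
def marg (μ : (ι → κ) → ℝ) (e : ι) (a : κ) : ℝ := ∑ c with c e = a, μ c

noncomputable def GG (μ : (ι → κ) → ℝ) : ℝ := ∑ e, ∑ a, Real.negMulLog (marg μ e a)

noncomputable def TC (μ : (ι → κ) → ℝ) : ℝ := GG μ - ∑ c, Real.negMulLog (μ c)

lemma marg_nonneg {μ : (ι → κ) → ℝ} (h : ∀ c, 0 ≤ μ c) (e : ι) (a : κ) : 0 ≤ marg μ e a :=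
  Finset.sum_nonneg fun c _ => h c

lemma marg_ge {μ : (ι → κ) → ℝ} (h : ∀ c, 0 ≤ μ c) (e : ι) (c : ι → κ) :
    μ c ≤ marg μ e (c e) :=
  Finset.single_le_sum (f := μ) (fun c _ => h c) (by simp)

lemma marg_sum (μ : (ι → κ) → ℝ) (e : ι) : ∑ a, marg μ e a = ∑ c, μ c := by
  unfold marg
  exact Finset.sum_fiberwise_of_maps_to (s := Finset.univ) (t := Finset.univ)
    (g := fun c : ι → κ => c e) (by simp) μ

lemma TC_ge {μ : (ι → κ) → ℝ} (h : ∀ c, 0 ≤ μ c) (h1 : ∑ c, μ c = 1) :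
    ∑ c with μ c = 0, ∏ e, marg μ e (c e) ≤ TC μ := by
  have hG : GG μ = - ∑ c, μ c * ∑ e, Real.log (marg μ e (c e)) := by
    unfold GG
    simp_rw [Finset.mul_sum]
    rw [Finset.sum_comm (f := fun (c : ι → κ) e => μ c * Real.log (marg μ e (c e))),
      ← Finset.sum_neg_distrib]
    refine Finset.sum_congr rfl fun e _ => ?_
    rw [← Finset.sum_fiberwise_of_maps_to (s := Finset.univ) (t := Finset.univ)
      (g := fun c : ι → κ => c e) (by simp) (fun c => μ c * Real.log (marg μ e (c e))),
      ← Finset.sum_neg_distrib]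
    refine Finset.sum_congr rfl fun a _ => ?_
    rw [Finset.sum_congr rfl (g := fun c => μ c * Real.log (marg μ e a))
      (fun c hc => by rw [(Finset.mem_filter.1 hc).2]), ← Finset.sum_mul, Real.negMulLog]
    simp [marg]
  have hν : ∑ c : ι → κ, ∏ e, marg μ e (c e) = 1 := by
    rw [← Fintype.piFinset_univ, ← Finset.prod_univ_sum]
    simp [marg_sum, h1]
  have hterm : ∀ c, μ c - (∏ e, marg μ e (c e)) + (if μ c = 0 then ∏ e, marg μ e (c e) else 0)
      ≤ -(μ c * ∑ e, Real.log (marg μ e (c e))) - Real.negMulLog (μ c) := by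
    intro c
    split_ifs with hc
    · simp [hc]
    · have hp : 0 < μ c := lt_of_le_of_ne (h c) (Ne.symm hc)
      have hm : ∀ e, 0 < marg μ e (c e) := fun e => hp.trans_le (marg_ge h e c)
      have hpr : 0 < ∏ e, marg μ e (c e) := Finset.prod_pos fun e _ => hm e
      have := Real.log_le_sub_one_of_pos (div_pos hpr hp)
      rw [Real.log_div hpr.ne' hp.ne', Real.log_prod (fun e _ => (hm e).ne')] at this
      have h2 := mul_le_mul_of_nonneg_left this hp.le
      have h3 : μ c * ((∏ e, marg μ e (c e)) / μ c - 1) = (∏ e, marg μ e (c e)) - μ c := by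
        field_simp
      rw [h3] at h2
      unfold Real.negMulLog
      linarith
  have := Finset.sum_le_sum (s := Finset.univ) (fun c _ => hterm c)
  rw [Finset.sum_add_distrib, Finset.sum_sub_distrib, Finset.sum_sub_distrib,
    Finset.sum_neg_distrib, ← hG, h1, hν, ← Finset.sum_filter] at this
  unfold TC
  linarith

lemma ent_le_log_supp {p : κ → ℝ} (h : ∀ a, 0 ≤ p a) (h1 : ∑ a, p a = 1) :
    ∑ a, Real.negMulLog (p a) ≤ Real.log ((Finset.univ.filter fun a => 0 < p a).card : ℝ) := by
  set t := Finset.univ.filter fun a => 0 < p a with ht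
  have hs : ∑ a ∈ t, p a = 1 := by
    rw [← h1]
    refine Finset.sum_subset (Finset.subset_univ _) fun a _ ha => ?_
    simp only [ht, Finset.mem_filter, Finset.mem_univ, true_and, not_lt] at ha
    exact le_antisymm ha (h a)
  have hne : t.Nonempty := by
    by_contra hn
    rw [Finset.not_nonempty_iff_eq_empty] at hn
    simp [hn] at hs
  have hc : (0 : ℝ) < t.card := by exact_mod_cast Finset.card_pos.2 hne
  have h2 : ∑ a, Real.negMulLog (p a) = ∑ a ∈ t, Real.negMulLog (p a) := by
    symm
    refine Finset.sum_subset (Finset.subset_univ _) fun a _ ha => ?_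
    simp only [ht, Finset.mem_filter, Finset.mem_univ, true_and, not_lt] at ha
    rw [le_antisymm ha (h a), Real.negMulLog_zero]
  have h3 : ∑ a ∈ t, (Real.negMulLog (p a) - p a * Real.log t.card) ≤
      ∑ a ∈ t, ((t.card : ℝ)⁻¹ - p a) := by
    refine Finset.sum_le_sum fun a ha => ?_
    have hp : 0 < p a := (Finset.mem_filter.1 ha).2
    have := Real.log_le_sub_one_of_pos (inv_pos.2 (mul_pos hp hc))
    rw [Real.log_inv, Real.log_mul hp.ne' hc.ne'] at this
    have h2 := mul_le_mul_of_nonneg_left this hp.le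
    have h3 : p a * ((p a * t.card)⁻¹ - 1) = (t.card : ℝ)⁻¹ - p a := by
      field_simp
    rw [h3] at h2
    unfold Real.negMulLog
    linarith
  rw [Finset.sum_sub_distrib, Finset.sum_sub_distrib, ← Finset.sum_mul, hs, Finset.sum_const,
    nsmul_eq_mul, mul_inv_cancel₀ hc.ne'] at h3
  rw [h2]
  linarith

lemma continuous_marg (e : ι) (a : κ) : Continuous fun μ : (ι → κ) → ℝ => marg μ e a := by
  unfold marg
  fun_prop

lemma continuous_GG : Continuous (GG : ((ι → κ) → ℝ) → ℝ) := by
  unfold GG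
  refine continuous_finsetSum _ fun e _ => continuous_finsetSum _ fun a _ => ?_
  exact Real.continuous_negMulLog.comp (continuous_marg e a)

lemma continuous_TC : Continuous (TC : ((ι → κ) → ℝ) → ℝ) := by
  unfold TC
  refine continuous_GG.sub (continuous_finsetSum _ fun c _ => ?_)
  exact Real.continuous_negMulLog.comp (continuous_apply c)

lemma compactness (A : Set (ι → κ)) (X : ℝ)
    (hX : ∀ t : ι → Finset κ, (∀ e, (t e).Nonempty) → (∀ c : ι → κ, (∀ e, c e ∈ t e) → c ∈ A) →
      ∑ e, Real.log ((t e).card : ℝ) ≤ X) (ε : ℝ) (hε : 0 < ε) :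
    ∃ K : ℝ, 0 ≤ K ∧ ∀ μ : (ι → κ) → ℝ, (∀ c, 0 ≤ μ c) → ∑ c, μ c = 1 →
      (∀ c, c ∉ A → μ c = 0) → GG μ ≤ X + ε + K * TC μ := by
  have hnn : ∀ μ : (ι → κ) → ℝ, (∀ c, 0 ≤ μ c) → ∑ c, μ c = 1 → 0 ≤ TC μ := by
    intro μ h h1
    refine le_trans ?_ (TC_ge h h1)
    exact Finset.sum_nonneg fun c _ => Finset.prod_nonneg fun e _ => marg_nonneg h e _
  set KK : Set ((ι → κ) → ℝ) := stdSimplex ℝ (ι → κ) ∩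
    ({μ | ∀ c, c ∉ A → μ c = 0} ∩ {μ | X + ε ≤ GG μ}) with hKK
  have hcomp : IsCompact KK := by
    refine (isCompact_stdSimplex ℝ (ι → κ)).inter_right (IsClosed.inter ?_ ?_)
    · simp only [Set.ofPred_forall]
      exact isClosed_iInter fun c => isClosed_iInter fun _ =>
        isClosed_eq (continuous_apply c) continuous_const
    · exact isClosed_le continuous_const continuous_GG
  have hpos : ∀ μ ∈ KK, 0 < TC μ := by
    rintro μ ⟨⟨h, h1⟩, h2, h3⟩
    have h3 : X + ε ≤ GG μ := h3
    have h2 : ∀ c, c ∉ A → μ c = 0 := h2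
    set t : ι → Finset κ := fun e => Finset.univ.filter fun a => 0 < marg μ e a with ht
    have hGle : GG μ ≤ ∑ e, Real.log ((t e).card : ℝ) :=
      Finset.sum_le_sum fun e _ => ent_le_log_supp (fun a => marg_nonneg h e a)
        ((marg_sum μ e).trans h1)
    have hne : ∀ e, (t e).Nonempty := by
      intro e
      by_contra hn
      rw [Finset.not_nonempty_iff_eq_empty] at hn
      have : ∑ a, marg μ e a ≤ 0 := by
        refine Finset.sum_nonpos fun a _ => ?_
        by_contra hc
        have : a ∈ t e := by simpa [ht] using hc
        simp [hn] at this
      rw [marg_sum, h1] at this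
      linarith
    obtain ⟨c, hc, hcA⟩ : ∃ c : ι → κ, (∀ e, c e ∈ t e) ∧ c ∉ A := by
      by_contra hcon
      push Not at hcon
      have := hX t hne hcon
      linarith
    have hνpos : 0 < ∏ e, marg μ e (c e) :=
      Finset.prod_pos fun e _ => (Finset.mem_filter.1 (hc e)).2
    refine lt_of_lt_of_le hνpos (le_trans ?_ (TC_ge h h1))
    exact Finset.single_le_sum (f := fun c : ι → κ => ∏ e, marg μ e (c e))
      (fun c _ => Finset.prod_nonneg fun e _ => marg_nonneg h e _) (by simp [h2 c hcA])
  have hcont : ContinuousOn (fun μ => (GG μ - (X + ε)) / TC μ) KK :=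
    ((continuous_GG.sub continuous_const).continuousOn).div continuous_TC.continuousOn
      (fun μ hμ => (hpos μ hμ).ne')
  obtain ⟨K, hK⟩ := (hcomp.image_of_continuousOn hcont).bddAbove
  refine ⟨max K 0, le_max_right _ _, fun μ h h1 h2 => ?_⟩
  by_cases hμ : X + ε ≤ GG μ
  · have hm : μ ∈ KK := ⟨⟨h, h1⟩, h2, hμ⟩
    have h3 : (GG μ - (X + ε)) / TC μ ≤ K := hK ⟨μ, hm, rfl⟩
    rw [div_le_iff₀ (hpos μ hm)] at h3
    have := mul_le_mul_of_nonneg_right (le_max_left K 0) (hpos μ hm).le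
    linarith
  · have := mul_nonneg (le_max_right K 0) (hnn μ h h1)
    linarith

end Compact

section Comb

abbrev VertSub (n m : ℕ) := {s : Finset (Fin n) // s.card = m}

def emb {n m : ℕ} (s : VertSub n m) : Fin m → Fin n := s.1.orderEmbOfFin s.2

lemma emb_mono {n m : ℕ} (s : VertSub n m) : StrictMono (emb s) := (s.1.orderEmbOfFin s.2).strictMono

lemma emb_range {n m : ℕ} (s : VertSub n m) : Set.range (emb s) = s.1 :=
  Finset.range_orderEmbOfFin s.1 s.2

lemma emb_inj {n m : ℕ} {s s' : VertSub n m} (h : emb s = emb s') : s = s' := by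
  apply Subtype.ext
  apply Finset.coe_injective
  rw [← emb_range, ← emb_range, h]

lemma Edge.map_inj {m n : ℕ} (φ : Fin m → Fin n) (h : StrictMono φ) :
    Function.Injective (Edge.map φ h) := by
  rintro ⟨⟨a, b⟩, hab⟩ ⟨⟨c, d⟩, hcd⟩ he
  simp only [Edge.map, Subtype.mk.injEq, Prod.mk.injEq] at he
  simp only [Subtype.mk.injEq, Prod.mk.injEq]
  exact ⟨h.injective he.1, h.injective he.2⟩

lemma card_edge (n : ℕ) : Fintype.card (Edge n) = n.choose 2 := by
  rw [Fintype.card_subtype, Finset.card_filter, Fintype.sum_prod_type_right]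
  have : ∀ j : Fin n, (∑ i : Fin n, if i < j then 1 else 0) = (j : ℕ) := by
    intro j
    rw [← Finset.card_filter]
    have : (Finset.univ.filter fun i : Fin n => i < j) = Finset.Iio j := by ext; simp
    rw [this, Fin.card_Iio]
  rw [Finset.sum_congr rfl (fun j _ => this j), Fin.sum_univ_eq_sum_range (fun i => i),
    Finset.sum_range_id, Nat.choose_two_right]

lemma card_sub (n m : ℕ) : Fintype.card (VertSub n m) = n.choose m := by
  rw [Fintype.card_finset_len, Fintype.card_fin]

lemma sum_map_eq {n m : ℕ} (s : VertSub n m) (F : Edge n → ℝ) :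
    ∑ e0 : Edge m, F (Edge.map (emb s) (emb_mono s) e0) =
      ∑ e : Edge n, if e.1.1 ∈ s.1 ∧ e.1.2 ∈ s.1 then F e else 0 := by
  rw [← Finset.sum_filter, ← Finset.sum_image (f := F) (g := Edge.map (emb s) (emb_mono s))
    (s := Finset.univ) (fun a _ b _ h => Edge.map_inj _ _ h)]
  congr 1
  ext ⟨⟨u, v⟩, huv⟩
  simp only [Finset.mem_image, Finset.mem_univ, true_and, Finset.mem_filter]
  have hm : ∀ x, x ∈ s.1 ↔ ∃ i, emb s i = x := by
    intro x
    rw [← Finset.mem_coe, ← emb_range]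
    rfl
  constructor
  · rintro ⟨e, he⟩
    simp only [Edge.map, Subtype.mk.injEq, Prod.mk.injEq] at he
    exact ⟨(hm u).2 ⟨_, he.1⟩, (hm v).2 ⟨_, he.2⟩⟩
  · rintro ⟨h1, h2⟩
    obtain ⟨i, hi⟩ := (hm u).1 h1
    obtain ⟨j, hj⟩ := (hm v).1 h2
    refine ⟨⟨(i, j), ?_⟩, ?_⟩
    · have : emb s i < emb s j := by rw [hi, hj]; exact huv
      exact (emb_mono s).lt_iff_lt.1 this
    · simp [Edge.map, hi, hj]

lemma count_sub {n m : ℕ} (hm : 2 ≤ m) (e : Edge n) :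
    (Finset.univ.filter fun s : VertSub n m => e.1.1 ∈ s.1 ∧ e.1.2 ∈ s.1).card =
      (n - 2).choose (m - 2) := by
  have hne : e.1.1 ≠ e.1.2 := e.2.ne
  have hc : ((Finset.univ.erase e.1.1).erase e.1.2).card = n - 2 := by
    rw [Finset.card_erase_of_mem (by simp [hne.symm]), Finset.card_erase_of_mem (by simp)]
    simp only [Finset.card_univ, Fintype.card_fin]
    omega
  rw [← hc, ← Finset.card_powersetCard]
  symm
  have hprop : ∀ t ∈ Finset.powersetCard (m - 2) ((Finset.univ.erase e.1.1).erase e.1.2),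
      e.1.1 ∉ t ∧ e.1.2 ∉ t ∧ (insert e.1.1 (insert e.1.2 t)).card = m := by
    intro t ht
    rw [Finset.mem_powersetCard] at ht
    have h1 : e.1.1 ∉ t := fun h => by simpa using ht.1 h
    have h2 : e.1.2 ∉ t := fun h => by simpa using ht.1 h
    refine ⟨h1, h2, ?_⟩
    rw [Finset.card_insert_of_notMem (by simp [hne, h1]), Finset.card_insert_of_notMem h2, ht.2]
    omega
  refine Finset.card_bij (fun t ht => ⟨insert e.1.1 (insert e.1.2 t), (hprop t ht).2.2⟩) ?_ ?_ ?_
  · intro t ht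
    simp
  · intro t ht t' ht' h
    have h := congrArg Subtype.val h
    simp only at h
    obtain ⟨a1, a2, -⟩ := hprop t ht
    obtain ⟨b1, b2, -⟩ := hprop t' ht'
    ext x
    have := Finset.ext_iff.1 h x
    simp only [Finset.mem_insert] at this
    by_cases hx1 : x = e.1.1
    · subst hx1; simp [a1, b1]
    · by_cases hx2 : x = e.1.2
      · subst hx2; simp [a2, b2]
      · simpa [hx1, hx2] using this
  · rintro ⟨s, hs⟩ h
    simp only [Finset.mem_filter, Finset.mem_univ, true_and] at h
    refine ⟨(s.erase e.1.1).erase e.1.2, ?_, ?_⟩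
    · rw [Finset.mem_powersetCard]
      refine ⟨Finset.erase_subset_erase _ (Finset.erase_subset_erase _ (Finset.subset_univ _)), ?_⟩
      rw [Finset.card_erase_of_mem (by simp [hne.symm, h.2]), Finset.card_erase_of_mem h.1, hs]
      omega
    · apply Subtype.ext
      simp only
      rw [Finset.insert_erase (by simp [hne.symm, h.2]), Finset.insert_erase h.1]

lemma double_count {n m : ℕ} (hm : 2 ≤ m) (F : Edge n → ℝ) :
    ∑ s : VertSub n m, ∑ e0 : Edge m, F (Edge.map (emb s) (emb_mono s) e0) =
      ((n - 2).choose (m - 2) : ℝ) * ∑ e, F e := by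
  simp_rw [sum_map_eq]
  rw [Finset.sum_comm, Finset.mul_sum]
  refine Finset.sum_congr rfl fun e _ => ?_
  rw [← Finset.sum_filter, Finset.sum_const, nsmul_eq_mul, count_sub hm e]

lemma double_count_const {n m : ℕ} (hm : 2 ≤ m) :
    ((n - 2).choose (m - 2) : ℝ) * (n.choose 2 : ℝ) = (n.choose m : ℝ) * (m.choose 2 : ℝ) := by
  have := double_count (n := n) hm (fun _ => (1 : ℝ))
  simp only [Finset.sum_const, nsmul_eq_mul, mul_one, Finset.card_univ, card_edge, card_sub] at this
  exact this.symm

def oth {n m : ℕ} (s : VertSub n m) (e0 : Edge m) : Finset (Fin n) :=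
  Finset.univ.image (fun i : {i : Fin m // i ≠ e0.1.1 ∧ i ≠ e0.1.2} => emb s i.1)

lemma card_oth_type {m : ℕ} (e0 : Edge m) :
    Fintype.card {i : Fin m // i ≠ e0.1.1 ∧ i ≠ e0.1.2} = m - 2 := by
  rw [Fintype.card_subtype]
  have : (Finset.univ.filter fun i : Fin m => i ≠ e0.1.1 ∧ i ≠ e0.1.2) =
      (Finset.univ.erase e0.1.1).erase e0.1.2 := by
    ext i
    simp [and_comm]
  have hne : e0.1.1 ≠ e0.1.2 := e0.2.ne
  rw [this, Finset.card_erase_of_mem (by simp [hne.symm]), Finset.card_erase_of_mem (by simp)]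
  simp only [Finset.card_univ, Fintype.card_fin]
  omega

lemma sum_oth_le {n m : ℕ} (e0 : Edge m) (D : Edge n → Finset (Fin n) → ℝ)
    (hD : ∀ e W, 0 ≤ D e W) (Δ : ℝ) (hΔ : ∀ W : Finset (Fin n), W.card ≤ m → ∑ e, D e W ≤ Δ) :
    ∑ s : VertSub n m, D (Edge.map (emb s) (emb_mono s) e0) (oth s e0) ≤ (n : ℝ) ^ (m - 2) * Δ := by
  classical
  let J := {i : Fin m // i ≠ e0.1.1 ∧ i ≠ e0.1.2}
  let pr : VertSub n m → Edge n × (J → Fin n) := fun s =>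
    (Edge.map (emb s) (emb_mono s) e0, fun i => emb s i.1)
  let G : Edge n × (J → Fin n) → ℝ := fun x => D x.1 (Finset.univ.image x.2)
  have hinj : Function.Injective pr := by
    intro s s' h
    simp only [pr, Prod.mk.injEq, Edge.map, Subtype.mk.injEq] at h
    apply emb_inj
    funext i
    by_cases h1 : i = e0.1.1
    · rw [h1]; exact h.1.1
    · by_cases h2 : i = e0.1.2
      · rw [h2]; exact h.1.2
      · exact congrFun h.2 ⟨i, h1, h2⟩
  calc _ = ∑ s : VertSub n m, G (pr s) := rfl
    _ = ∑ x ∈ Finset.univ.image pr, G x := by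
        rw [Finset.sum_image (fun a _ b _ h => hinj h)]
    _ ≤ ∑ x, G x := Finset.sum_le_univ_sum_of_nonneg (fun x => hD _ _)
    _ = ∑ w : J → Fin n, ∑ e, G (e, w) := Fintype.sum_prod_type_right _
    _ ≤ ∑ w : J → Fin n, Δ := by
        refine Finset.sum_le_sum fun w _ => hΔ (Finset.univ.image w) ?_
        refine Finset.card_image_le.trans ?_
        rw [Finset.card_univ]
        have := card_oth_type e0
        simp only [J]
        omega
    _ = _ := by
        rw [Finset.sum_const, nsmul_eq_mul, Finset.card_univ, Fintype.card_fun, Fintype.card_fin,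
          card_oth_type]
        push_cast
        rfl

def touch {n : ℕ} (R : Finset (Fin n)) : Finset (Edge n) :=
  Finset.univ.filter fun e => e.1.1 ∈ R ∨ e.1.2 ∈ R

lemma touch_mono {n : ℕ} {R R' : Finset (Fin n)} (h : R ⊆ R') : touch R ⊆ touch R' := by
  intro e he
  simp only [touch, Finset.mem_filter, Finset.mem_univ, true_and] at he ⊢
  exact he.imp (fun x => h x) (fun x => h x)

lemma card_touch {n : ℕ} (R : Finset (Fin n)) : (touch R).card ≤ 2 * R.card * n := by
  have : (touch R).image Subtype.val ⊆ (R ×ˢ Finset.univ) ∪ (Finset.univ ×ˢ R) := by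
    intro p hp
    simp only [touch, Finset.mem_image, Finset.mem_filter, Finset.mem_univ, true_and] at hp
    obtain ⟨e, he, rfl⟩ := hp
    simpa using he
  have h1 := Finset.card_le_card this
  rw [Finset.card_image_of_injective _ Subtype.val_injective] at h1
  have h2 := Finset.card_union_le (R ×ˢ (Finset.univ : Finset (Fin n))) (Finset.univ ×ˢ R)
  rw [Finset.card_product, Finset.card_product, Finset.card_univ, Fintype.card_fin] at h2
  linarith [mul_comm n R.card]

lemma clique_touch {n m : ℕ} (s : VertSub n m) (e0 : Edge m) (R : Finset (Fin n)) :
    ((Finset.univ.image (Edge.map (emb s) (emb_mono s))).erase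
      (Edge.map (emb s) (emb_mono s) e0)) ∪ touch R ⊆ touch (R ∪ oth s e0) := by
  intro e he
  rcases Finset.mem_union.1 he with he | he
  · obtain ⟨h1, h2⟩ := Finset.mem_erase.1 he
    obtain ⟨f, -, rfl⟩ := Finset.mem_image.1 h2
    have hf : f ≠ e0 := fun h => h1 (by rw [h])
    have : (f.1.1 ≠ e0.1.1 ∧ f.1.1 ≠ e0.1.2) ∨ (f.1.2 ≠ e0.1.1 ∧ f.1.2 ≠ e0.1.2) := by
      by_contra hcon
      apply hf
      have h3 := f.2
      have h4 := e0.2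
      apply Subtype.ext
      apply Prod.ext <;> omega
    simp only [touch, Finset.mem_filter, Finset.mem_univ, true_and, Finset.mem_union, oth,
      Finset.mem_image, Subtype.exists]
    rcases this with h | h
    · exact Or.inl (Or.inr ⟨_, h, rfl⟩)
    · exact Or.inr (Or.inr ⟨_, h, rfl⟩)
  · exact touch_mono Finset.subset_union_left he

end Comb

set_option maxHeartbeats 1000000 in
lemma per_phi {k m n : ℕ} (S : Finset (Colouring k n)) (A : Set (Colouring k m))
    (φ : Fin m → Fin n) (h : StrictMono φ)
    (hA : ∀ c ∈ S, restrictC c φ h ∈ A) (Y K : ℝ)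
    (hK : ∀ μ : Colouring k m → ℝ, (∀ c, 0 ≤ μ c) → ∑ c, μ c = 1 →
      (∀ c, c ∉ A → μ c = 0) → GG μ ≤ Y + K * TC μ) (Q : Finset (Edge n)) :
    ∑ e0, (LL S Q - LL S (insert (Edge.map φ h e0) Q)) ≤ S.card * Y +
      K * (∑ e0, (LL S Q - LL S (insert (Edge.map φ h e0) Q)) -
        (LL S Q - LL S (Finset.univ.image (Edge.map φ h) ∪ Q))) := by
  classical
  have hper : ∀ x ∈ S,
      ∑ e0, (Real.log ((cls S Q x).card : ℝ) - ((cls S Q x).card : ℝ)⁻¹ *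
        ∑ y ∈ cls S Q x, Real.log ((cls (cls S Q x) {Edge.map φ h e0} y).card : ℝ)) ≤
      Y + K * (∑ e0, (Real.log ((cls S Q x).card : ℝ) - ((cls S Q x).card : ℝ)⁻¹ *
        ∑ y ∈ cls S Q x, Real.log ((cls (cls S Q x) {Edge.map φ h e0} y).card : ℝ)) -
        (Real.log ((cls S Q x).card : ℝ) - ((cls S Q x).card : ℝ)⁻¹ *
        ∑ y ∈ cls S Q x,
          Real.log ((cls (cls S Q x) (Finset.univ.image (Edge.map φ h)) y).card : ℝ))) := by
    intro x hx
    have hBc := cls_pos Q hx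
    have hBS : ∀ y ∈ cls S Q x, y ∈ S := fun y hy => (mem_cls.1 hy).1
    generalize cls S Q x = B at hBc hBS
    have hBne : B.Nonempty := Finset.card_pos.1 (by exact_mod_cast hBc)
    set μ : Colouring k m → ℝ := fun c =>
      ((B.filter (fun y => restrictC y φ h = c)).card : ℝ) / B.card with hμ
    have hmarg : ∀ e0 a, marg μ e0 a =
        ((B.filter (fun y => y (Edge.map φ h e0) = a)).card : ℝ) / B.card := by
      intro e0 a
      unfold marg
      rw [hμ, ← Finset.sum_div, ← Nat.cast_sum]
      congr 2
      rw [Finset.card_eq_sum_card_fiberwise (f := fun y => restrictC y φ h)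
        (t := Finset.univ.filter fun c : Colouring k m => c e0 = a)]
      · refine Finset.sum_congr rfl fun c hc => ?_
        congr 1
        ext y
        simp only [Finset.mem_filter, Finset.mem_univ, true_and] at hc ⊢
        constructor
        · rintro ⟨h1, h2⟩
          refine ⟨⟨h1, ?_⟩, h2⟩
          rw [← hc, ← h2]
          rfl
        · rintro ⟨⟨h1, -⟩, h2⟩
          exact ⟨h1, h2⟩
      · intro y hy
        have hy' := (Finset.mem_filter.1 hy).2
        simp only [Finset.coe_filter, Finset.mem_univ, true_and, Set.mem_ofPred_eq]
        exact hy'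
    have hG : GG μ = ∑ e0, (Real.log (B.card : ℝ) - (B.card : ℝ)⁻¹ *
        ∑ y ∈ B, Real.log ((cls B {Edge.map φ h e0} y).card : ℝ)) := by
      unfold GG
      refine Finset.sum_congr rfl fun e0 _ => ?_
      simp_rw [hmarg]
      rw [entropy_push B hBne (fun y => y (Edge.map φ h e0))]
      congr 2
      refine Finset.sum_congr rfl fun y _ => ?_
      congr 3
      ext z
      simp [mem_cls]
    have hH : ∑ c, Real.negMulLog (μ c) = Real.log (B.card : ℝ) - (B.card : ℝ)⁻¹ *
        ∑ y ∈ B, Real.log ((cls B (Finset.univ.image (Edge.map φ h)) y).card : ℝ) := by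
      simp only [hμ]
      rw [entropy_push B hBne (fun y => restrictC y φ h)]
      congr 2
      refine Finset.sum_congr rfl fun y _ => ?_
      congr 3
      ext z
      simp only [mem_cls, Finset.mem_filter, Finset.mem_image, Finset.mem_univ, true_and,
        forall_exists_index, forall_apply_eq_imp_iff, funext_iff, restrictC]
    have hμ0 : ∀ c, 0 ≤ μ c := fun c => by
      rw [hμ]
      exact div_nonneg (Nat.cast_nonneg _) (Nat.cast_nonneg _)
    have hμ1 : ∑ c, μ c = 1 := by
      rw [hμ, ← Finset.sum_div, ← Nat.cast_sum,
        ← Finset.card_eq_sum_card_fiberwise (f := fun y => restrictC y φ h) (by simp),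
        div_self hBc.ne']
    have hμA : ∀ c, c ∉ A → μ c = 0 := by
      intro c hc
      have : B.filter (fun y => restrictC y φ h = c) = ∅ := by
        rw [Finset.filter_eq_empty_iff]
        intro y hy hyc
        exact hc (hyc ▸ hA y (hBS y hy))
      rw [hμ]
      simp only [this, Finset.card_empty, Nat.cast_zero, zero_div]
    have hfin := hK μ hμ0 hμ1 hμA
    unfold TC at hfin
    rw [hH, hG] at hfin
    exact hfin
  have hsum := Finset.sum_le_sum hper
  rw [Finset.sum_add_distrib, ← Finset.mul_sum, Finset.sum_sub_distrib, Finset.sum_comm] at hsum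
  simp_rw [sum_fibre, ← Finset.insert_eq] at hsum
  simpa using hsum

lemma upper_core {k m n : ℕ} (hk : 2 ≤ k) (hm : 2 ≤ m) (hmn : m ≤ n)
    (S : Finset (Colouring k n)) (hS : S.Nonempty) (A : Set (Colouring k m))
    (hA : ∀ c ∈ S, ∀ (φ : Fin m → Fin n) (h : StrictMono φ), restrictC c φ h ∈ A) (Y K : ℝ)
    (hK0 : 0 ≤ K)
    (hK : ∀ μ : Colouring k m → ℝ, (∀ c, 0 ≤ μ c) → ∑ c, μ c = 1 →
      (∀ c, c ∉ A → μ c = 0) → GG μ ≤ Y + K * TC μ) (δ : ℝ) (hδ : 0 < δ) :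
    ∃ r : ℕ, (r : ℝ) * δ ≤ m * Real.log k ∧
      ((n - 2).choose (m - 2) : ℝ) * (Real.log S.card - 2 * r * n * Real.log k) ≤
        (n.choose m : ℝ) * Y + K * ((m.choose 2 : ℝ) * ((n : ℝ) ^ (m - 2) *
          (δ * (n.choose 2 : ℝ)))) := by
  classical
  have : Nonempty (Fin k) := ⟨⟨0, by omega⟩⟩
  have hl : 0 < Real.log k := Real.log_pos (by exact_mod_cast hk)
  have hN : (0 : ℝ) < S.card := by exact_mod_cast Finset.card_pos.2 hS
  have hE : (0 : ℝ) < n.choose 2 := by exact_mod_cast Nat.choose_pos (hm.trans hmn)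
  have hm0 : (0 : ℝ) < m := by exact_mod_cast (by omega : 0 < m)
  set N : ℝ := (S.card : ℝ) with hNdef
  set E : ℝ := (n.choose 2 : ℝ) with hEdef
  set T : Finset (Fin n) → Edge n → ℝ := fun R e =>
    LL S (touch R) - LL S (insert e (touch R)) with hT
  have hTnn : ∀ R e, 0 ≤ T R e := fun R e => sub_nonneg.2 (LL_mono S (Finset.subset_insert _ _))
  have hTanti : ∀ R R' e, R ⊆ R' → T R' e ≤ T R e := fun R R' e h =>
    LL_submod S (touch_mono h) e
  set Φ : Finset (Fin n) → ℝ := fun R => ∑ e, T R e + δ / m * E * N * R.card with hΦ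
  obtain ⟨R, hR⟩ := Finite.exists_min Φ
  have htouch : touch (∅ : Finset (Fin n)) = ∅ := by simp [touch]
  have hempty : ∀ e, T ∅ e ≤ N * Real.log k := by
    intro e
    have h1 : LL S ∅ = N * Real.log N := by
      have : ∀ x, cls S ∅ x = S := by
        intro x
        ext y
        simp [mem_cls]
      simp [LL, this, hNdef]
    have h2 := LL_lower S hS {e}
    simp only [Finset.card_singleton, Nat.cast_one, one_mul, Fintype.card_fin] at h2
    simp only [hT, htouch, h1, insert_empty_eq]
    linarith
  have hcardE : ((Finset.univ : Finset (Edge n)).card : ℝ) = E := by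
    rw [Finset.card_univ, card_edge]
  have hRcard : (R.card : ℝ) * δ ≤ m * Real.log k := by
    have h1 := hR ∅
    simp only [hΦ, Finset.card_empty, Nat.cast_zero, mul_zero, add_zero] at h1
    have h2 : ∑ e, T ∅ e ≤ E * (N * Real.log k) := by
      refine (Finset.sum_le_sum fun e _ => hempty e).trans ?_
      rw [Finset.sum_const, nsmul_eq_mul, hcardE]
    have h3 : 0 ≤ ∑ e, T R e := Finset.sum_nonneg fun e _ => hTnn R e
    have h4 : δ / m * E * N * R.card ≤ E * (N * Real.log k) := by linarith
    have h5 : (E * N) * (δ / m * R.card) ≤ (E * N) * Real.log k := by linarith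
    have h6 := le_of_mul_le_mul_left h5 (mul_pos hE hN)
    rw [div_mul_eq_mul_div, div_le_iff₀ hm0] at h6
    linarith
  refine ⟨R.card, hRcard, ?_⟩
  set D : Edge n → Finset (Fin n) → ℝ := fun e W => T R e - T (R ∪ W) e with hD
  have hDnn : ∀ e W, 0 ≤ D e W := fun e W =>
    sub_nonneg.2 (hTanti _ _ e Finset.subset_union_left)
  have hDsum : ∀ W : Finset (Fin n), W.card ≤ m → ∑ e, D e W ≤ δ * E * N := by
    intro W hW
    have h1 := hR (R ∪ W)
    simp only [hΦ] at h1
    have h2 : ((R ∪ W).card : ℝ) ≤ R.card + m := by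
      exact_mod_cast (Finset.card_union_le R W).trans (by omega)
    have h3 : δ / m * E * N * (R ∪ W).card ≤ δ / m * E * N * (R.card + m) := by gcongr
    have h4 : δ / m * E * N * (R.card + m) = δ / m * E * N * R.card + δ * E * N := by
      field_simp
    simp only [hD, Finset.sum_sub_distrib]
    linarith
  have hs : ∀ s : VertSub n m, ∑ e0, T R (Edge.map (emb s) (emb_mono s) e0) ≤
      N * Y + K * ∑ e0, D (Edge.map (emb s) (emb_mono s) e0) (oth s e0) := by
    intro s
    have h1 := per_phi S A (emb s) (emb_mono s) (fun c hc => hA c hc _ _) Y K hK (touch R)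
    have hinj := Edge.map_inj (emb s) (emb_mono s)
    have h2 := LL_superadd S (touch R) (Finset.univ.image (Edge.map (emb s) (emb_mono s)))
      (Function.extend (Edge.map (emb s) (emb_mono s)) (fun e0 => touch (R ∪ oth s e0))
        (fun _ => ∅)) (by
          intro e he
          obtain ⟨e0, -, rfl⟩ := Finset.mem_image.1 he
          rw [hinj.extend_apply]
          exact clique_touch s e0 R)
    rw [Finset.sum_image (fun a _ b _ h => hinj h)] at h2
    simp only [hinj.extend_apply] at h2
    refine h1.trans ?_
    gcongr
    simp only [hD, hT, Finset.sum_sub_distrib] at h2 ⊢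
    linarith
  have htot := Finset.sum_le_sum (s := Finset.univ) fun s _ => hs s
  rw [double_count hm, Finset.sum_add_distrib, ← Finset.mul_sum, ← Finset.mul_sum,
    Finset.sum_comm, Finset.sum_const,
    nsmul_eq_mul, Finset.card_univ, card_sub] at htot
  have h7 : ∑ e0 : Edge m, ∑ s : VertSub n m,
      D (Edge.map (emb s) (emb_mono s) e0) (oth s e0) ≤
      (m.choose 2 : ℝ) * ((n : ℝ) ^ (m - 2) * (δ * E * N)) := by
    refine (Finset.sum_le_sum fun e0 _ => sum_oth_le e0 D hDnn _ hDsum).trans ?_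
    rw [Finset.sum_const, nsmul_eq_mul, Finset.card_univ, card_edge]
  have h8 : N * (Real.log N - 2 * R.card * n * Real.log k) ≤ ∑ e, T R e := by
    have a1 := LL_subadd S (touch R) Finset.univ
    have a2 := LL_lower S hS (touch R)
    rw [Fintype.card_fin] at a2
    have a3 : LL S (Finset.univ ∪ touch R) = 0 := by
      unfold LL
      refine Finset.sum_eq_zero fun x hx => ?_
      have : cls S (Finset.univ ∪ touch R) x = {x} := by
        ext y
        simp only [mem_cls, Finset.mem_union, Finset.mem_univ, true_or, true_implies,
          Finset.mem_singleton]
        constructor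
        · rintro ⟨-, h⟩
          exact funext h
        · rintro rfl
          exact ⟨hx, fun _ => rfl⟩
      simp [this]
    have a4 : ((touch R).card : ℝ) ≤ 2 * R.card * n := by exact_mod_cast card_touch R
    have a5 : N * (Real.log N - 2 * R.card * n * Real.log k) ≤
        N * (Real.log N - (touch R).card * Real.log k) := by gcongr
    simp only [hT]
    linarith
  have h9 : ((n - 2).choose (m - 2) : ℝ) * (N * (Real.log N - 2 * R.card * n * Real.log k)) ≤
      ((n - 2).choose (m - 2) : ℝ) * ∑ e, T R e := by gcongr
  have h10 := mul_le_mul_of_nonneg_left h7 hK0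
  refine le_of_mul_le_mul_left ?_ hN
  linarith

section Ex
variable {k n : ℕ}

lemma exSet_finite (A : Set (Colouring k n)) :
    {x | ∃ t : Template k n, Proper t ∧ (∀ c, Realises c t → c ∈ A) ∧ Ent t = x}.Finite := by
  refine (Set.finite_range (Ent : Template k n → ℝ)).subset ?_
  rintro x ⟨t, -, -, rfl⟩
  exact ⟨t, rfl⟩

lemma exists_exEnt {A : Set (Colouring k n)} (hA : A.Nonempty) :
    ∃ t : Template k n, Proper t ∧ (∀ c, Realises c t → c ∈ A) ∧ Ent t = exEnt A := by
  obtain ⟨c, hc⟩ := hA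
  have hne : {x | ∃ t : Template k n, Proper t ∧ (∀ c, Realises c t → c ∈ A) ∧
      Ent t = x}.Nonempty := by
    refine ⟨_, fun e => {c e}, fun e => by simp, fun c' hc' => ?_, rfl⟩
    have : c' = c := funext fun e => by simpa using hc' e
    rwa [this]
  exact hne.csSup_mem (exSet_finite A)

lemma le_exEnt {A : Set (Colouring k n)} (t : Template k n) (h1 : Proper t)
    (h2 : ∀ c, Realises c t → c ∈ A) : Ent t ≤ exEnt A :=
  le_csSup (exSet_finite A).bddAbove ⟨t, h1, h2, rfl⟩

lemma Ent_mul_log (hk : 2 ≤ k) (t : Template k n) :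
    Ent t * Real.log k = ∑ e, Real.log ((t e).card : ℝ) := by
  have hl : 0 < Real.log k := Real.log_pos (by exact_mod_cast hk)
  unfold Ent
  rw [Finset.sum_mul]
  refine Finset.sum_congr rfl fun e _ => ?_
  rw [Real.logb, div_mul_cancel₀ _ hl.ne']

lemma rpow_exEnt_le (hk : 2 ≤ k) {A : Set (Colouring k n)} (hA : A.Nonempty) :
    (k : ℝ) ^ (exEnt A) ≤ (A.ncard : ℝ) := by
  classical
  have hk0 : (0 : ℝ) < k := by exact_mod_cast (by omega : 0 < k)
  obtain ⟨t, h1, h2, h3⟩ := exists_exEnt hA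
  have h4 : (k : ℝ) ^ (exEnt A) = ((Fintype.piFinset t).card : ℝ) := by
    rw [Fintype.card_piFinset, ← h3, Real.rpow_def_of_pos hk0, mul_comm, Ent_mul_log hk,
      Real.exp_sum]
    push_cast
    refine Finset.prod_congr rfl fun e _ => Real.exp_log ?_
    exact_mod_cast Finset.card_pos.2 (h1 e)
  rw [h4, ← Set.ncard_coe_finset]
  have : ((Fintype.piFinset t : Finset (Colouring k n)) : Set (Colouring k n)) ⊆ A := by
    intro c hc
    apply h2
    intro e
    exact Fintype.mem_piFinset.1 (Finset.mem_coe.1 hc) e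
  exact_mod_cast Set.ncard_le_ncard this (Set.toFinite _)

lemma exEnt_mono {P : ∀ n, Set (Colouring k n)} (hP : OrderHereditary P)
    (hne : ∀ n, (P n).Nonempty) {m n : ℕ} (hm : 2 ≤ m) (hmn : m ≤ n) :
    exEnt (P n) / (n.choose 2 : ℝ) ≤ exEnt (P m) / (m.choose 2 : ℝ) := by
  classical
  obtain ⟨t, h1, h2, h3⟩ := exists_exEnt (hne n)
  have hs : ∀ s : VertSub n m, ∑ e0, Real.logb k
      ((t (Edge.map (emb s) (emb_mono s) e0)).card) ≤ exEnt (P m) := by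
    intro s
    refine le_exEnt (restrictT t (emb s) (emb_mono s)) (fun e => h1 _) ?_
    intro c hc
    have hinj := Edge.map_inj (emb s) (emb_mono s)
    choose d hd using h1
    set c' : Colouring k n := Function.extend (Edge.map (emb s) (emb_mono s)) c d with hc'
    have hr : restrictC c' (emb s) (emb_mono s) = c := by
      funext e
      simp only [restrictC, hc']
      rw [hinj.extend_apply]
    rw [← hr]
    apply hP
    apply h2
    intro e
    by_cases he : ∃ e0, Edge.map (emb s) (emb_mono s) e0 = e
    · obtain ⟨e0, rfl⟩ := he
      rw [hc', hinj.extend_apply]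
      exact hc e0
    · rw [hc', Function.extend_apply' _ _ _ he]
      exact hd e
  have htot := Finset.sum_le_sum (s := Finset.univ) fun s _ => hs s
  rw [double_count hm (fun e => Real.logb k ((t e).card)), Finset.sum_const, nsmul_eq_mul,
    Finset.card_univ, card_sub] at htot
  change _ * Ent t ≤ _ at htot
  rw [h3] at htot
  have hE : (0 : ℝ) < n.choose 2 := by exact_mod_cast Nat.choose_pos (hm.trans hmn)
  have hM : (0 : ℝ) < m.choose 2 := by exact_mod_cast Nat.choose_pos hm
  have hB : (0 : ℝ) < n.choose m := by exact_mod_cast Nat.choose_pos hmn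
  have hc := double_count_const (n := n) hm
  rw [div_le_div_iff₀ hE hM]
  have h5 := mul_le_mul_of_nonneg_right htot hE.le
  refine le_of_mul_le_mul_left ?_ hB
  calc _ = exEnt (P n) * ((n.choose m : ℝ) * (m.choose 2 : ℝ)) := by ring
    _ = ((n - 2).choose (m - 2) : ℝ) * exEnt (P n) * (n.choose 2 : ℝ) := by rw [← hc]; ring
    _ ≤ _ := by linarith

end Ex

lemma pow_le_choose_mul {n m : ℕ} (h : 2 * m ≤ n) :
    (n : ℝ) ^ m ≤ (2 : ℝ) ^ m * (m.factorial : ℝ) * (n.choose m : ℝ) := by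
  have h1 := Nat.pow_le_choose (α := ℝ) m n
  have hf : (0 : ℝ) < m.factorial := by exact_mod_cast m.factorial_pos
  rw [div_le_iff₀ hf] at h1
  have h2 : (n : ℝ) ≤ 2 * ((n + 1 - m : ℕ) : ℝ) := by
    exact_mod_cast (by omega : n ≤ 2 * (n + 1 - m))
  calc (n : ℝ) ^ m ≤ (2 * ((n + 1 - m : ℕ) : ℝ)) ^ m := by gcongr
    _ = 2 ^ m * ((n + 1 - m : ℕ) : ℝ) ^ m := by rw [mul_pow]
    _ ≤ 2 ^ m * ((n.choose m : ℝ) * m.factorial) := by gcongr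
    _ = _ := by ring

/-- Speed of order-hereditary properties (Corollary 2.17). -/
theorem speed_of_hereditary (k : ℕ) (hk : 2 ≤ k)
    (P : ∀ n, Set (Colouring k n)) (hP : OrderHereditary P)
    (hne : ∀ n, (P n).Nonempty) (π : ℝ)
    (hπ : Tendsto (fun n => exEnt (P n) / (n.choose 2 : ℝ)) atTop (nhds π))
    (ε : ℝ) (hε : 0 < ε) :
    ∃ n₀ : ℕ, ∀ n, n₀ ≤ n →
      (k : ℝ) ^ (π * (n.choose 2 : ℝ)) ≤ ((P n).ncard : ℝ) ∧
      ((P n).ncard : ℝ) ≤ (k : ℝ) ^ ((π + ε) * (n.choose 2 : ℝ)) := by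
  classical
  have hk0 : (0 : ℝ) < k := by exact_mod_cast (by omega : 0 < k)
  have hk1 : (1 : ℝ) ≤ k := by exact_mod_cast (by omega : 1 ≤ k)
  have hl : 0 < Real.log k := Real.log_pos (by exact_mod_cast hk)
  -- choice of `m`
  obtain ⟨m, hm, hmex⟩ : ∃ m : ℕ, 2 ≤ m ∧ exEnt (P m) / (m.choose 2 : ℝ) < π + ε / 4 := by
    have h1 : ∀ᶠ n in atTop, exEnt (P n) / (n.choose 2 : ℝ) < π + ε / 4 :=
      hπ.eventually_lt_const (by linarith)
    obtain ⟨m, h2, h3⟩ := ((eventually_ge_atTop 2).and h1).exists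
    exact ⟨m, h2, h3⟩
  have hM : (0 : ℝ) < m.choose 2 := by exact_mod_cast Nat.choose_pos hm
  rw [div_lt_iff₀ hM] at hmex
  set l := Real.log k with hldef
  set M : ℝ := (m.choose 2 : ℝ) with hMdef
  obtain ⟨K, hK0, hK⟩ := compactness (P m) (exEnt (P m) * l)
    (fun t h1 h2 => by
      rw [← Ent_mul_log hk t]
      exact mul_le_mul_of_nonneg_right (le_exEnt t h1 h2) hl.le) (ε * M * l / 4) (by positivity)
  set H : ℝ := (2 : ℝ) ^ m * (m.factorial : ℝ) with hH
  have hHpos : 0 < H := by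
    have : (0 : ℝ) < m.factorial := by exact_mod_cast m.factorial_pos
    positivity
  set δ : ℝ := ε * l / (4 * (K + 1) * H) with hδdef
  have hδ : 0 < δ := by positivity
  have hKδ : K * H * δ ≤ ε * l / 4 := by
    have h1 : (K + 1) * H * δ = ε * l / 4 := by
      rw [hδdef]
      field_simp
    have h2 : 0 < H * δ := by positivity
    linarith
  obtain ⟨n₁, hn₁⟩ := exists_nat_gt (16 * (m * l / δ) / ε)
  refine ⟨max (2 * m) (n₁ + 1), fun n hn => ⟨?_, ?_⟩⟩
  · have hn2 : 2 ≤ n := by have := le_of_max_le_left hn; omega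
    have hE : (0 : ℝ) < n.choose 2 := by exact_mod_cast Nat.choose_pos hn2
    have h1 : π ≤ exEnt (P n) / (n.choose 2 : ℝ) := by
      refine le_of_tendsto hπ ?_
      filter_upwards [eventually_ge_atTop n] with N hN
      exact exEnt_mono hP hne hn2 hN
    rw [le_div_iff₀ hE] at h1
    exact (Real.rpow_le_rpow_of_exponent_le hk1 h1).trans (rpow_exEnt_le hk (hne n))
  · have hnm : 2 * m ≤ n := le_of_max_le_left hn
    have hnn₁ : n₁ + 1 ≤ n := le_of_max_le_right hn
    have hn2 : 2 ≤ n := by omega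
    have hmn : m ≤ n := by omega
    have hE : (0 : ℝ) < n.choose 2 := by exact_mod_cast Nat.choose_pos hn2
    have hB : (0 : ℝ) < n.choose m := by exact_mod_cast Nat.choose_pos hmn
    set S : Finset (Colouring k n) := (Set.toFinite (P n)).toFinset with hSdef
    have hSmem : ∀ c, c ∈ S ↔ c ∈ P n := fun c => by simp [hSdef]
    have hS : S.Nonempty := by
      obtain ⟨c, hc⟩ := hne n
      exact ⟨c, (hSmem c).2 hc⟩
    have hScard : (P n).ncard = S.card := Set.ncard_eq_toFinset_card _ _
    have hN : (0 : ℝ) < S.card := by exact_mod_cast Finset.card_pos.2 hS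
    obtain ⟨r, hr, hmain⟩ := upper_core hk hm hmn S hS (P m)
      (fun c hc φ h => hP m n φ h c ((hSmem c).1 hc)) _ K hK0 hK δ hδ
    rw [hScard, Real.rpow_def_of_pos hk0, ← Real.log_le_iff_le_exp hN]
    by_contra hcon
    push Not at hcon
    rw [← hldef] at hcon hmain hr
    rw [← hMdef] at hmain
    set E : ℝ := (n.choose 2 : ℝ) with hEdef
    set B : ℝ := (n.choose m : ℝ) with hBdef
    set c : ℝ := ((n - 2).choose (m - 2) : ℝ) with hcdef
    have hcE : c * E = B * M := double_count_const hm
    have hcpos : 0 < c := by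
      have : 0 < c * E := by rw [hcE]; positivity
      exact pos_of_mul_pos_left this hE.le
    -- the revealed edges are few
    have hEeq : E = n * (n - 1) / 2 := by
      rw [hEdef, Nat.cast_choose_two]
    have hn0 : (0 : ℝ) < n := by exact_mod_cast (by omega : 0 < n)
    have hfew : 2 * r * n ≤ ε / 4 * E := by
      have h1 : (r : ℝ) ≤ m * l / δ := by rwa [le_div_iff₀ hδ]
      have h2 : 16 * (m * l / δ) < n₁ * ε := by rwa [div_lt_iff₀ hε] at hn₁
      have h3 : (n₁ : ℝ) + 1 ≤ n := by exact_mod_cast hnn₁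
      have h4 : (n₁ : ℝ) * ε ≤ (n - 1) * ε := by
        apply mul_le_mul_of_nonneg_right _ hε.le
        linarith
      have h5 : 16 * (r : ℝ) ≤ (n - 1) * ε := by linarith
      have h6 := mul_le_mul_of_nonneg_right h5 hn0.le
      rw [hEeq]
      linarith
    have hpow : (n : ℝ) ^ (m - 2) * E ≤ H * B := by
      have h1 : E ≤ (n : ℝ) ^ 2 := by
        rw [hEeq]
        nlinarith
      calc (n : ℝ) ^ (m - 2) * E ≤ (n : ℝ) ^ (m - 2) * (n : ℝ) ^ 2 := by gcongr
        _ = (n : ℝ) ^ m := by rw [← pow_add]; congr 1; omega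
        _ ≤ _ := pow_le_choose_mul hnm
    have e1 : c * (l * ((π + ε) * E) - ε / 4 * E * l) <
        c * (Real.log S.card - 2 * r * n * l) := by
      have h1 := mul_le_mul_of_nonneg_right hfew hl.le
      apply mul_lt_mul_of_pos_left _ hcpos
      linarith
    have e2 : c * (l * ((π + ε) * E) - ε / 4 * E * l) = B * M * (l * (π + 3 * ε / 4)) := by
      rw [← hcE]
      ring
    have e3 : B * (exEnt (P m) * l + ε * M * l / 4) ≤ B * M * (l * (π + ε / 2)) := by
      have h1 := mul_le_mul_of_nonneg_left (mul_le_mul_of_nonneg_right hmex.le hl.le) hB.le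
      linarith
    have e4 : K * (M * ((n : ℝ) ^ (m - 2) * (δ * E))) ≤ B * M * (ε * l / 4) := by
      calc _ = K * M * δ * ((n : ℝ) ^ (m - 2) * E) := by ring
        _ ≤ K * M * δ * (H * B) := by gcongr
        _ = B * M * (K * H * δ) := by ring
        _ ≤ _ := by gcongr
    rw [e2] at e1
    have e5 := e1.trans_le (hmain.trans (add_le_add e3 e4))
    have e6 : B * M * (l * (π + ε / 2)) + B * M * (ε * l / 4) =
      B * M * (l * (π + 3 * ε / 4)) := by ring
    linarith
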